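/- Under the even-case construction, the cost of the permutation algorithm's matching satisfies C(π_A) ≥ (k-1)(k+1)/2 - ε/8. -/

import Mathlib

/-!
Even-case construction: k ≥ 2 even, 0 < ε ≤ 1.  Servers s_1,...,s_k at
positions 0,...,k-1 (s_i at position i-1).  ε_i = (ε/8)·2^(i-k) for i < k and
ε_k = 1/2.  Requests (1-indexed): for j = 1,...,k/2,
r_{2j-1} = (k/2 + j - 1) - 1/2 - ε_{2j-1},  r_{2j} = (k/2 - j) - 1/2 + ε_{2j}.
A matching is a function f : ℕ → ℕ sending each request index i ∈ {1,...,k} to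
a server index f i ∈ {1,...,k} (at position f i - 1); its cost is
C(f) = ∑_{i=1}^k |r_i - (f i - 1)|.
-/

/-- `ε_i`: equals `(ε/8)·2^(i-k)` for `i < k` and `1/2` for `i = k`. -/
noncomputable def eps (k : ℕ) (ε : ℝ) (i : ℕ) : ℝ :=
  if i = k then 1 / 2 else ε / 8 * (2 : ℝ) ^ ((i : ℤ) - (k : ℤ))

/-- The request `r_i` (1-indexed, `1 ≤ i ≤ k`): writing `i = 2j-1` or `i = 2j`,
`r_{2j-1} = (k/2 + j - 1) - 1/2 - ε_{2j-1}` and `r_{2j} = (k/2 - j) - 1/2 + ε_{2j}`. -/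
noncomputable def req (k : ℕ) (ε : ℝ) (i : ℕ) : ℝ :=
  if i % 2 = 1 then ((k : ℝ) / 2 + (((i + 1) / 2 : ℕ) : ℝ) - 1) - 1 / 2 - eps k ε i
  else ((k : ℝ) / 2 - ((i / 2 : ℕ) : ℝ)) - 1 / 2 + eps k ε i

/-- Cost of the matching sending request `i` to server `f i` (position `f i - 1`). -/
noncomputable def cost (k : ℕ) (ε : ℝ) (f : ℕ → ℕ) : ℝ :=
  ∑ i ∈ Finset.Icc 1 k, |req k ε i - ((f i : ℝ) - 1)|

/-- The permutation algorithm's matching `π_A`: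
`π_A(2j-1) = k/2 - j + 1`, `π_A(2j) = k/2 + j`. -/
def piA (k : ℕ) (i : ℕ) : ℕ :=
  if i % 2 = 1 then k / 2 - (i + 1) / 2 + 1 else k / 2 + i / 2

/-- The offline matching `π_B`: `π_B(2j-1) = k/2 + j`, `π_B(2j) = k/2 - j + 1`. -/
def piB (k : ℕ) (i : ℕ) : ℕ :=
  if i % 2 = 1 then k / 2 + (i + 1) / 2 else k / 2 - i / 2 + 1

/-- The total of the `ε_i` telescopes to at most `1/2 + ε/8`. -/
theorem sum_eps_le (k : ℕ) (hk : 1 ≤ k) (ε : ℝ) (hε : 0 ≤ ε) :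
    ∑ i ∈ Finset.Icc 1 k, eps k ε i ≤ 1 / 2 + ε / 8 := by
  have partial_sum : ∀ n : ℕ, n < k →
      ∑ i ∈ Finset.Icc 1 n, eps k ε i ≤ ε / 8 * (2 : ℝ) ^ ((n : ℤ) + 1 - (k : ℤ)) := by
    intro n
    induction n with
    | zero =>
      intro _
      simp only [zero_lt_one, Finset.Icc_eq_empty_of_lt, Finset.sum_empty]
      positivity
    | succ n ih =>
      intro hn
      rw [Finset.sum_Icc_succ_top (by omega)]
      have h := ih (by omega)
      have hpow : (2 : ℝ) ^ (((n + 1 : ℕ) : ℤ) + 1 - (k : ℤ))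
          = 2 * (2 : ℝ) ^ ((n : ℤ) + 1 - (k : ℤ)) := by
        rw [← zpow_one_add₀ two_ne_zero]
        congr 1
        push_cast
        ring
      rw [hpow, eps, if_neg (by omega)]
      push_cast
      linarith
  obtain ⟨n, rfl⟩ : ∃ n, k = n + 1 := ⟨k - 1, by omega⟩
  rw [Finset.sum_Icc_succ_top (by omega)]
  have h := partial_sum n (by omega)
  have hlast : eps (n + 1) ε (n + 1) = 1 / 2 := if_pos rfl
  push_cast at h
  rw [sub_self, zpow_zero, mul_one] at h
  linarith

theorem le_abs_req_sub_piA (k : ℕ) (hke : Even k) (ε : ℝ) (i : ℕ) (hi : i ∈ Finset.Icc 1 k) :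
    (i : ℝ) - 1 / 2 - eps k ε i ≤ |req k ε i - ((piA k i : ℝ) - 1)| := by
  obtain ⟨m, rfl⟩ := hke
  rw [Finset.mem_Icc] at hi
  have hm : (m + m) / 2 = m := by omega
  rcases Nat.even_or_odd' i with ⟨j, rfl | rfl⟩
  · have hpar : ¬ 2 * j % 2 = 1 := by omega
    have hj : 2 * j / 2 = j := by omega
    rw [req, piA, if_neg hpar, if_neg hpar, hm, hj]
    refine le_trans (le_of_eq ?_) (neg_le_abs _)
    push_cast
    ring
  · have hpar : (2 * j + 1) % 2 = 1 := by omega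
    have hj : (2 * j + 1 + 1) / 2 = j + 1 := by omega
    have hjm : j + 1 ≤ m := by omega
    rw [req, piA, if_pos hpar, if_pos hpar, hm, hj]
    refine le_trans (le_of_eq ?_) (le_abs_self _)
    push_cast [Nat.cast_sub hjm]
    ring

theorem sum_Icc_sub_half (k : ℕ) :
    ∑ i ∈ Finset.Icc 1 k, ((i : ℝ) - 1 / 2) = (k : ℝ) ^ 2 / 2 := by
  induction k with
  | zero => simp
  | succ n ih =>
    rw [Finset.sum_Icc_succ_top (by omega), ih]
    push_cast
    ring

/-- Even case: C(π_A) ≥ (k-1)(k+1)/2 - ε/8. -/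
theorem even_permCost_lower (k : ℕ) (hk : 2 ≤ k) (hke : Even k)
    (ε : ℝ) (hε : 0 < ε) (hε1 : ε ≤ 1) :
    cost k ε (piA k) ≥ ((k : ℝ) - 1) * ((k : ℝ) + 1) / 2 - ε / 8 := by
  have hsum := Finset.sum_le_sum (le_abs_req_sub_piA k hke ε)
  rw [Finset.sum_sub_distrib, sum_Icc_sub_half] at hsum
  have heps := sum_eps_le k (by omega) ε hε.le
  rw [cost]
  linarith
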